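/- Fix real numbers N > 0 and q > 0. Then the function S ↦ p̂(S, N, 1, q) = Q( √S / √( (q/(2S) + 1)/N + q/(4S·N²) + 1 ) ) is strictly decreasing on (0, ∞). -/

import Mathlib

open MeasureTheory

/-- The Gaussian tail function `Q(x) = (1/√(2π)) · ∫_x^∞ exp(−t²/2) dt`. -/
noncomputable def gaussQ (x : ℝ) : ℝ :=
  (Real.sqrt (2 * Real.pi))⁻¹ * ∫ t in Set.Ioi x, Real.exp (-t ^ 2 / 2)

/-- The approximate probability of error `p̂(S, N, γ, q)` from the paper. -/
noncomputable def phat (S N γ q : ℝ) : ℝ :=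
  (1 / 2) * gaussQ ((Real.sqrt S + (1 / (4 * N)) * ((1 - γ) / γ) * (q / Real.sqrt S)) /
      Real.sqrt ((1 / (4 * N)) * ((1 + γ) / γ) * (q / S)
        + (1 / (8 * N ^ 2)) * ((1 + γ ^ 2) / γ ^ 2) * (q / S) + 1 / (γ * N) + 1))
  + (1 / 2) * gaussQ ((Real.sqrt S - (1 / (4 * N)) * ((1 - γ) / γ) * (q / Real.sqrt S)) /
      Real.sqrt ((1 / (4 * N)) * ((1 + γ) / γ) * (q / S)
        + (1 / (8 * N ^ 2)) * ((1 + γ ^ 2) / γ ^ 2) * (q / S) + 1 / N + 1))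

theorem integrable_exp_neg_sq_div_two :
    Integrable (fun t : ℝ => Real.exp (-t ^ 2 / 2)) := by
  refine (integrable_exp_neg_mul_sq (b := 1 / 2) (by norm_num)).congr (.of_forall fun t => ?_)
  ring_nf

theorem gaussQ_strictAnti : StrictAnti gaussQ := by
  intro a b hab
  have hint := integrable_exp_neg_sq_div_two
  have hpos : 0 < ∫ t in a..b, Real.exp (-t ^ 2 / 2) :=
    intervalIntegral.intervalIntegral_pos_of_pos hint.intervalIntegrable
      (fun t => Real.exp_pos _) hab
  have hsplit := intervalIntegral.integral_interval_add_Ioi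
    (hint.integrableOn (s := Set.Ioi a)) (hint.integrableOn (s := Set.Ioi b))
  unfold gaussQ
  refine mul_lt_mul_of_pos_left ?_ (by positivity)
  linarith

theorem phat_balanced (S N q : ℝ) :
    phat S N 1 q = gaussQ (Real.sqrt S /
      Real.sqrt ((q / (2 * S) + 1) / N + q / (4 * S * N ^ 2) + 1)) := by
  have h : (1 / (4 * N)) * ((1 + 1) / 1) * (q / S)
        + (1 / (8 * N ^ 2)) * ((1 + 1 ^ 2) / 1 ^ 2) * (q / S) + 1 / N + 1
      = (q / (2 * S) + 1) / N + q / (4 * S * N ^ 2) + 1 := by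
    ring
  simp only [phat, one_mul, sub_self, zero_div, mul_zero, zero_mul, add_zero, sub_zero, h]
  ring

theorem phat_strictAnti_in_S (N q : ℝ) (hN : 0 < N) (hq : 0 < q) :
    StrictAntiOn (fun S : ℝ => phat S N 1 q) (Set.Ioi 0) := by
  intro S hS T hT hST
  simp only [Set.mem_Ioi] at hS hT
  simp only [phat_balanced]
  refine gaussQ_strictAnti ?_
  have hsqrt : Real.sqrt S < Real.sqrt T := Real.sqrt_lt_sqrt hS.le hST
  refine div_lt_div₀ hsqrt (Real.sqrt_le_sqrt ?_) (Real.sqrt_nonneg T)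
    (Real.sqrt_pos.2 (by positivity))
  gcongr
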